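/- Let α,β∈{+,−} and let (G_n)_{n∈ℕ} be a sequence of random directed multigraphs satisfying the regularity condition, with |E_n|→∞ in probability. Then Kendall's tau statistic converges: τ_α^β(G_n) → τ(𝒟^α,𝒟^β) in probability as n→∞, where τ(X,Y)=E[𝓗_{X,Y}(X,Y)]−1. -/

import Mathlib

open Finset MeasureTheory ProbabilityTheory Filter

/-! ### Finite directed multigraphs given by edge multiplicities -/

/-- Total number of edges (counted with multiplicity). -/
def edgeCount {V : Type*} [Fintype V] (m : V × V → ℕ) : ℕ := ∑ e, m e

/-- Out-degree `D⁺(v) = Σ_w m(v,w)`. -/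
def outDeg {V : Type*} [Fintype V] (m : V × V → ℕ) (v : V) : ℕ := ∑ w, m (v, w)

/-- In-degree `D⁻(v) = Σ_w m(w,v)`. -/
def inDeg {V : Type*} [Fintype V] (m : V × V → ℕ) (v : V) : ℕ := ∑ w, m (w, v)

/-- Degree of type `α` (`true` = `+` = out, `false` = `−` = in). -/
def deg {V : Type*} [Fintype V] (m : V × V → ℕ) (α : Bool) (v : V) : ℕ :=
  if α then outDeg m v else inDeg m v

/-- Average rank `R̄^α(π e)`. -/
noncomputable def avgRank {V : Type*} [Fintype V] (m : V × V → ℕ) (α : Bool)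
    (π : V × V → V) (e : V × V) : ℝ :=
  1 / 2 + ∑ f, (m f : ℝ) *
    ((if deg m α (π e) < deg m α (π f) then 1 else 0) +
      1 / 2 * (if deg m α (π f) = deg m α (π e) then 1 else 0))

/-- Empirical joint cdf
`H_G^{α,β}(k,l) = Σ_e (m(e)/|E|)·1{D^α(π_*e) ≤ k}·1{D^β(π*e) ≤ l}`. -/
noncomputable def empJointCdf {V : Type*} [Fintype V] (m : V × V → ℕ) (α β : Bool)
    (k l : ℤ) : ℝ :=
  ∑ e, (m e : ℝ) / (edgeCount m : ℝ) *
    (if (deg m α e.1 : ℤ) ≤ k ∧ (deg m β e.2 : ℤ) ≤ l then 1 else 0)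

/-! ### Rank correlations of integer-valued random variables -/

/-- `F_X(k) = P(X ≤ k)`. -/
noncomputable def intCdf {Ω : Type*} [MeasurableSpace Ω] (μ : Measure Ω)
    (X : Ω → ℤ) (k : ℤ) : ℝ :=
  (μ {ω | X ω ≤ k}).toReal

/-- `𝓕_X(k) = F_X(k) + F_X(k−1)`. -/
noncomputable def scriptF {Ω : Type*} [MeasurableSpace Ω] (μ : Measure Ω)
    (X : Ω → ℤ) (k : ℤ) : ℝ :=
  intCdf μ X k + intCdf μ X (k - 1)

/-- Spearman's rho `ρ(X,Y) = 3·E[𝓕_X(X)𝓕_Y(Y)] − 3`. -/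
noncomputable def spearman {Ω : Type*} [MeasurableSpace Ω] (μ : Measure Ω)
    (X Y : Ω → ℤ) : ℝ :=
  3 * ∫ ω, scriptF μ X (X ω) * scriptF μ Y (Y ω) ∂μ - 3

/-- Joint cdf `H_{X,Y}(k,l) = P(X ≤ k, Y ≤ l)`. -/
noncomputable def intJointCdf {Ω : Type*} [MeasurableSpace Ω] (μ : Measure Ω)
    (X Y : Ω → ℤ) (k l : ℤ) : ℝ :=
  (μ {ω | X ω ≤ k ∧ Y ω ≤ l}).toReal

/-- `𝓗_{X,Y}(k,l)`. -/
noncomputable def scriptH {Ω : Type*} [MeasurableSpace Ω] (μ : Measure Ω)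
    (X Y : Ω → ℤ) (k l : ℤ) : ℝ :=
  intJointCdf μ X Y k l + intJointCdf μ X Y (k - 1) l +
    intJointCdf μ X Y k (l - 1) + intJointCdf μ X Y (k - 1) (l - 1)

/-- Kendall's tau `τ(X,Y) = E[𝓗_{X,Y}(X,Y)] − 1`. -/
noncomputable def kendall {Ω : Type*} [MeasurableSpace Ω] (μ : Measure Ω)
    (X Y : Ω → ℤ) : ℝ :=
  ∫ ω, scriptH μ X Y (X ω) (Y ω) ∂μ - 1

/-- `S_X = E[F_X(X)·F_X(X−1)]`. -/
noncomputable def sFactor {Ω : Type*} [MeasurableSpace Ω] (μ : Measure Ω)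
    (X : Ω → ℤ) : ℝ :=
  ∫ ω, intCdf μ X (X ω) * intCdf μ X (X ω - 1) ∂μ

/-! ### The three rank-correlation statistics of a multigraph -/

/-- The random rank of the `i`-th copy of edge `e` computed from realized tie-breaking
values `u` (indexed by an edge slot together with a copy index):
`R^α(π e) = Σ_{f∈E} 1{D^α(π f) + u_f ≥ D^α(π e) + u_e}`. -/
noncomputable def rank {V : Type*} [Fintype V] (m : V × V → ℕ) (α : Bool)
    (π : V × V → V) (u : (V × V) × ℕ → ℝ) (e : V × V) (i : ℕ) : ℝ :=
  ∑ f : V × V, ∑ j ∈ Finset.range (m f),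
    if (deg m α (π e) : ℝ) + u (e, i) ≤ (deg m α (π f) : ℝ) + u (f, j) then 1 else 0

/-- Spearman's rho with uniform tie-breaking:
`ρ_α^β(G) = [12·Σ_{e∈E} R^α(π_*e)R^β(π*e) − 3|E|(|E|+1)²]/(|E|³−|E|)`. -/
noncomputable def rhoStat {V : Type*} [Fintype V] (m : V × V → ℕ) (α β : Bool)
    (u w : (V × V) × ℕ → ℝ) : ℝ :=
  (12 * ∑ e : V × V, ∑ i ∈ Finset.range (m e),
      rank m α Prod.fst u e i * rank m β Prod.snd w e i -
    3 * (edgeCount m : ℝ) * ((edgeCount m : ℝ) + 1) ^ 2) /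
  ((edgeCount m : ℝ) ^ 3 - (edgeCount m : ℝ))

/-- Spearman's rho with average-rank tie resolution (`0` by Lean's conventions for `/0`
if a denominator factor vanishes). -/
noncomputable def rhoBarStat {V : Type*} [Fintype V] (m : V × V → ℕ) (α β : Bool) : ℝ :=
  (4 * ∑ e : V × V, (m e : ℝ) * avgRank m α Prod.fst e * avgRank m β Prod.snd e -
    (edgeCount m : ℝ) * ((edgeCount m : ℝ) + 1) ^ 2) /
  (Real.sqrt (4 * ∑ e : V × V, (m e : ℝ) * avgRank m α Prod.fst e ^ 2 -
      (edgeCount m : ℝ) * ((edgeCount m : ℝ) + 1) ^ 2) *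
   Real.sqrt (4 * ∑ e : V × V, (m e : ℝ) * avgRank m β Prod.snd e ^ 2 -
      (edgeCount m : ℝ) * ((edgeCount m : ℝ) + 1) ^ 2))

/-- Kendall's tau statistic `τ_α^β(G) = 2(N_C − N_D)/(|E|(|E|−1))`; here `2N_C` (resp.
`2N_D`) is realized as the number of *ordered* pairs of distinct concordant (resp.
discordant) edges, the conditions being symmetric. -/
noncomputable def tauStat {V : Type*} [Fintype V] [DecidableEq V]
    (m : V × V → ℕ) (α β : Bool) : ℝ :=
  (((Finset.univ.filter (fun p : ((e : V × V) × Fin (m e)) × ((e : V × V) × Fin (m e)) =>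
        p.1 ≠ p.2 ∧ 0 < ((deg m α p.1.1.1 : ℤ) - (deg m α p.2.1.1 : ℤ)) *
          ((deg m β p.1.1.2 : ℤ) - (deg m β p.2.1.2 : ℤ)))).card : ℝ) -
    ((Finset.univ.filter (fun p : ((e : V × V) × Fin (m e)) × ((e : V × V) × Fin (m e)) =>
        p.1 ≠ p.2 ∧ ((deg m α p.1.1.1 : ℤ) - (deg m α p.2.1.1 : ℤ)) *
          ((deg m β p.1.1.2 : ℤ) - (deg m β p.2.1.2 : ℤ)) < 0)).card : ℝ)) /
  ((edgeCount m : ℝ) * ((edgeCount m : ℝ) - 1))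

/-! ### Auxiliary material for the proof -/

/-- The filter of events on `ℕ × Ω` whose probability tends to one. -/
def probFilter {Ω : Type*} [MeasurableSpace Ω] (μ : Measure Ω) : Filter (ℕ × Ω) where
  sets := {A | Tendsto (fun n => μ {ω | (n, ω) ∉ A}) atTop (nhds 0)}
  univ_sets := by simp
  sets_of_superset := by
    intro A B hA hAB
    refine tendsto_of_tendsto_of_tendsto_of_le_of_le tendsto_const_nhds hA (fun _ => zero_le) ?_
    intro n
    exact measure_mono fun ω hω h => hω (hAB h)
  inter_sets := by
    intro A B hA hB
    have h := Tendsto.add hA hB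
    rw [add_zero] at h
    refine tendsto_of_tendsto_of_tendsto_of_le_of_le tendsto_const_nhds h (fun _ => zero_le) ?_
    intro n
    refine le_trans (measure_mono ?_) (measure_union_le _ _)
    intro ω hω
    by_contra hc
    simp only [Set.mem_union, Set.mem_ofPred_eq, not_or, not_not] at hc
    exact hω ⟨hc.1, hc.2⟩

lemma mem_probFilter {Ω : Type*} [MeasurableSpace Ω] (μ : Measure Ω) (A : Set (ℕ × Ω)) :
    A ∈ probFilter μ ↔ Tendsto (fun n => μ {ω | (n, ω) ∉ A}) atTop (nhds 0) := Iff.rfl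

lemma tendstoInMeasure_iff_probFilter {Ω : Type*} [MeasurableSpace Ω] (μ : Measure Ω)
    (f : ℕ → Ω → ℝ) (c : ℝ) :
    TendstoInMeasure μ f atTop (fun _ => c) ↔
      Tendsto (fun x : ℕ × Ω => f x.1 x.2) (probFilter μ) (nhds c) := by
  rw [tendstoInMeasure_iff_dist, Metric.tendsto_nhds]
  refine forall₂_congr fun ε _ => ?_
  rw [Filter.Eventually, mem_probFilter]
  simp

lemma tendsto_l1 {ι Z : Type*} (F : Filter ι) (q : ι → Z → ℝ) (p : Z → ℝ)
    (hq0 : ∀ i z, 0 ≤ q i z) (hp0 : ∀ z, 0 ≤ p z) (hp : HasSum p 1)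
    (hq : ∀ᶠ i in F, HasSum (q i) 1)
    (h : ∀ z, Tendsto (fun i => q i z) F (nhds (p z))) :
    Tendsto (fun i => ∑' z, |q i z - p z|) F (nhds 0) := by
  have h1 : Tendsto (fun i => ∑' z, 2 * max (p z - q i z) 0) F (nhds (∑' _ : Z, (0:ℝ))) := by
    refine tendsto_tsum_of_dominated_convergence (bound := fun z => 2 * p z)
      (hp.summable.mul_left 2) ?_ ?_
    · intro z
      have : Tendsto (fun i => 2 * max (p z - q i z) 0) F (nhds (2 * max (p z - p z) 0)) :=
        ((tendsto_const_nhds.sub (h z)).max tendsto_const_nhds).const_mul 2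
      simpa using this
    · refine Eventually.of_forall fun i z => ?_
      have h1 := hq0 i z
      have h2 := hp0 z
      rw [Real.norm_eq_abs, abs_of_nonneg (by positivity)]
      have : max (p z - q i z) 0 ≤ p z := max_le (by linarith) h2
      linarith
  rw [tsum_zero] at h1
  refine h1.congr' ?_
  filter_upwards [hq] with i hi
  have hs : HasSum (fun z => q i z - p z) 0 := by simpa using hi.sub hp
  have hmax : Summable fun z => 2 * max (p z - q i z) 0 := by
    refine Summable.of_nonneg_of_le (fun z => by positivity) (fun z => ?_) (hp.summable.mul_left 2)
    have h1 := hq0 i z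
    have : max (p z - q i z) 0 ≤ p z := max_le (by linarith) (hp0 z)
    linarith
  have h3 := hmax.hasSum.add hs
  rw [add_zero] at h3
  rw [← h3.tsum_eq]
  refine tsum_congr fun z => ?_
  rcases le_total (q i z) (p z) with h | h
  · rw [max_eq_left (by linarith), abs_of_nonpos (by linarith)]; ring
  · rw [max_eq_right (by linarith), abs_of_nonneg (by linarith)]; ring

lemma bilin_bound {Z : Type*} (q p : Z → ℝ) (s : Z → Z → ℝ) (hs : ∀ z w, |s z w| ≤ 1)
    (hq0 : ∀ z, 0 ≤ q z) (hp0 : ∀ z, 0 ≤ p z) (hp : HasSum p 1) (hq : HasSum q 1) :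
    |(∑' x : Z × Z, q x.1 * q x.2 * s x.1 x.2) - ∑' x : Z × Z, p x.1 * p x.2 * s x.1 x.2|
      ≤ 2 * ∑' z, |q z - p z| := by
  have key : ∀ r : Z → ℝ, (∀ z, 0 ≤ r z) → Summable r →
      Summable fun x : Z × Z => r x.1 * r x.2 * s x.1 x.2 := by
    intro r hr0 hr
    refine Summable.of_norm_bounded (hr.mul_of_nonneg hr hr0 hr0) fun x => ?_
    rw [Real.norm_eq_abs, abs_mul, abs_of_nonneg (mul_nonneg (hr0 _) (hr0 _))]
    exact mul_le_of_le_one_right (mul_nonneg (hr0 _) (hr0 _)) (hs _ _)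
  have hd : Summable fun z => |q z - p z| := (hq.summable.sub hp.summable).abs
  have hd0 : 0 ≤ fun z => |q z - p z| := fun z => abs_nonneg _
  have a1 := hd.mul_of_nonneg hq.summable hd0 hq0
  have a2 := hp.summable.mul_of_nonneg hd hp0 hd0
  have b1 : ∑' x : Z × Z, |q x.1 - p x.1| * q x.2 = ∑' z, |q z - p z| := by
    have := hd.tsum_mul_tsum hq.summable a1
    rw [← this, hq.tsum_eq, mul_one]
  have b2 : ∑' x : Z × Z, p x.1 * |q x.2 - p x.2| = ∑' z, |q z - p z| := by
    have := hp.summable.tsum_mul_tsum hd a2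
    rw [← this, hp.tsum_eq, one_mul]
  rw [← (key q hq0 hq.summable).tsum_sub (key p hp0 hp.summable)]
  have hb : HasSum (fun x : Z × Z => |q x.1 - p x.1| * q x.2 + p x.1 * |q x.2 - p x.2|)
      (2 * ∑' z, |q z - p z|) := by
    have := a1.hasSum.add a2.hasSum
    rw [b1, b2] at this
    rwa [two_mul]
  rw [← Real.norm_eq_abs]
  refine tsum_of_norm_bounded hb fun x => ?_
  rw [Real.norm_eq_abs]
  have e : q x.1 * q x.2 * s x.1 x.2 - p x.1 * p x.2 * s x.1 x.2
      = ((q x.1 - p x.1) * q x.2 + p x.1 * (q x.2 - p x.2)) * s x.1 x.2 := by ring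
  rw [e, abs_mul]
  refine (mul_le_of_le_one_right (abs_nonneg _) (hs _ _)).trans ?_
  refine (abs_add_le _ _).trans ?_
  rw [abs_mul, abs_mul, abs_of_nonneg (hq0 _), abs_of_nonneg (hp0 _)]

/-- Concordance sign of two points of `ℤ²`. -/
def csign (z w : ℤ × ℤ) : ℝ := ((Int.sign ((z.1 - w.1) * (z.2 - w.2)) : ℤ) : ℝ)

lemma abs_csign_le (z w : ℤ × ℤ) : |csign z w| ≤ 1 := by
  unfold csign
  rcases lt_trichotomy ((z.1 - w.1) * (z.2 - w.2)) 0 with h | h | h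
  · simp [Int.sign_eq_neg_one_of_neg h]
  · simp [h]
  · simp [Int.sign_eq_one_of_pos h]

/-- `1{y ≤ x} + 1{y ≤ x - 1}`. -/
def stepA (x y : ℤ) : ℝ := (if y ≤ x then 1 else 0) + (if y ≤ x - 1 then 1 else 0)

lemma stepA_eq (x y : ℤ) : stepA x y = ((Int.sign (x - y) : ℤ) : ℝ) + 1 := by
  unfold stepA
  rcases lt_trichotomy x y with h | h | h
  · rw [Int.sign_eq_neg_one_of_neg (by omega), if_neg (by omega), if_neg (by omega)]; simp
  · subst h; simp
  · rw [Int.sign_eq_one_of_pos (by omega), if_pos (by omega), if_pos (by omega)]; simp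

lemma stepA_symm (x y : ℤ) : stepA x y + stepA y x = 2 := by
  rw [stepA_eq, stepA_eq, ← neg_sub x y, Int.sign_neg]
  push_cast; ring

lemma csign_eq (z w : ℤ × ℤ) :
    csign z w = stepA z.1 w.1 * stepA z.2 w.2 - stepA z.1 w.1 - stepA z.2 w.2 + 1 := by
  rw [stepA_eq, stepA_eq, csign, Int.sign_mul]
  push_cast; ring

lemma stepA_nonneg (x y : ℤ) : 0 ≤ stepA x y := by unfold stepA; positivity

lemma stepA_le (x y : ℤ) : stepA x y ≤ 2 := by
  have := stepA_symm x y; have := stepA_nonneg y x; linarith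

lemma integrable_of_bdd {Z : Type*} [MeasurableSpace Z] [DiscreteMeasurableSpace Z]
    (ν : Measure Z) [IsFiniteMeasure ν] (g : Z → ℝ) (C : ℝ) (h : ∀ z, |g z| ≤ C)
    (hg : Measurable g) : Integrable g ν :=
  Integrable.of_bound hg.aestronglyMeasurable C (Eventually.of_forall h)

lemma int4_add {Z : Type*} [MeasurableSpace Z] (ν : Measure Z) (f g h k : Z → ℝ)
    (hf : Integrable f ν) (hg : Integrable g ν) (hh : Integrable h ν) (hk : Integrable k ν) :
    ∫ x, f x ∂ν + ∫ x, g x ∂ν + ∫ x, h x ∂ν + ∫ x, k x ∂ν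
      = ∫ x, (f x + g x + h x + k x) ∂ν := by
  have a1 : Integrable (fun x => f x + g x) ν := hf.add hg
  have a2 : Integrable (fun x => f x + g x + h x) ν := a1.add hh
  rw [integral_add a2 hk, integral_add a1 hh, integral_add hf hg]

lemma int4_sub {Z : Type*} [MeasurableSpace Z] (ν : Measure Z) (f g h k : Z → ℝ)
    (hf : Integrable f ν) (hg : Integrable g ν) (hh : Integrable h ν) (hk : Integrable k ν) :
    ∫ x, f x ∂ν - ∫ x, g x ∂ν - ∫ x, h x ∂ν + ∫ x, k x ∂ν
      = ∫ x, (f x - g x - h x + k x) ∂ν := by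
  have a1 : Integrable (fun x => f x - g x) ν := hf.sub hg
  have a2 : Integrable (fun x => f x - g x - h x) ν := a1.sub hh
  rw [integral_add a2 hk, integral_sub a1 hh, integral_sub hf hg]

lemma hasSum_singletons {Z : Type*} [MeasurableSpace Z] [Countable Z] [MeasurableSingletonClass Z]
    (ν : Measure Z) [IsProbabilityMeasure ν] : HasSum (fun z => ν.real {z}) 1 := by
  have h := integral_countable (μ := ν) (f := fun _ : Z => (1:ℝ)) (integrable_const _)
  simp at h
  have hs : Summable (fun z => ν.real {z}) := by
    by_contra hc
    rw [tsum_eq_zero_of_not_summable hc] at h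
    exact one_ne_zero h
  rw [h]
  exact hs.hasSum

lemma integral_stepA (ν : Measure (ℤ × ℤ)) [IsProbabilityMeasure ν] (π : ℤ × ℤ → ℤ) :
    ∫ x, stepA (π x.1) (π x.2) ∂(ν.prod ν) = 1 := by
  have hi : Integrable (fun x : (ℤ × ℤ) × (ℤ × ℤ) => stepA (π x.1) (π x.2)) (ν.prod ν) :=
    Integrable.of_bound (Measurable.of_discrete).aestronglyMeasurable 2
      (Eventually.of_forall fun x => by
        rw [Real.norm_eq_abs, abs_of_nonneg (stepA_nonneg _ _)]; exact stepA_le _ _)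
  have hsw : ∫ x, stepA (π x.2) (π x.1) ∂(ν.prod ν) = ∫ x, stepA (π x.1) (π x.2) ∂(ν.prod ν) :=
    integral_prod_swap (μ := ν) (ν := ν) (fun x => stepA (π x.1) (π x.2))
  have hi' : Integrable (fun x : (ℤ × ℤ) × (ℤ × ℤ) => stepA (π x.2) (π x.1)) (ν.prod ν) :=
    hi.swap
  have h2 := integral_add hi hi'
  simp only [stepA_symm, hsw] at h2
  simp at h2
  linarith

lemma kendall_eq {Ω' : Type*} [MeasurableSpace Ω'] (μ' : Measure Ω') [IsProbabilityMeasure μ']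
    (DA DB : Ω' → ℤ) (hDA : Measurable DA) (hDB : Measurable DB) :
    kendall μ' DA DB =
      ∑' x : (ℤ × ℤ) × (ℤ × ℤ), (μ'.map (fun ω => (DA ω, DB ω))).real {x.1} *
        (μ'.map (fun ω => (DA ω, DB ω))).real {x.2} * csign x.1 x.2 := by
  have hm : Measurable (fun ω => (DA ω, DB ω)) := hDA.prodMk hDB
  set ν := μ'.map (fun ω => (DA ω, DB ω)) with hν
  have : IsProbabilityMeasure ν := Measure.isProbabilityMeasure_map hm.aemeasurable
  have hH : ∀ k l, intJointCdf μ' DA DB k l =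
      ∫ w : ℤ × ℤ, (if w.1 ≤ k ∧ w.2 ≤ l then (1:ℝ) else 0) ∂ν := by
    intro k l
    have : (fun w : ℤ × ℤ => (if w.1 ≤ k ∧ w.2 ≤ l then (1:ℝ) else 0)) =
        Set.indicator {w : ℤ × ℤ | w.1 ≤ k ∧ w.2 ≤ l} 1 := by
      ext w; simp [Set.indicator_apply]
    rw [this, integral_indicator_one (MeasurableSet.of_discrete), measureReal_def, hν,
      Measure.map_apply hm MeasurableSet.of_discrete]
    rfl
  have hint : ∀ k l : ℤ, Integrable (fun w : ℤ × ℤ => (if w.1 ≤ k ∧ w.2 ≤ l then (1:ℝ) else 0)) ν :=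
    fun k l => Integrable.of_bound (Measurable.of_discrete).aestronglyMeasurable 1
      (Eventually.of_forall fun w => by split_ifs <;> simp)
  have hS : ∀ k l, scriptH μ' DA DB k l = ∫ w : ℤ × ℤ, stepA k w.1 * stepA l w.2 ∂ν := by
    intro k l
    unfold scriptH
    rw [hH, hH, hH, hH, int4_add ν _ _ _ _ (hint _ _) (hint _ _) (hint _ _) (hint _ _)]
    refine integral_congr_ae (Eventually.of_forall fun w => ?_)
    simp only [stepA, ite_and]
    split_ifs <;> norm_num
  have hbnd : ∀ x y x' y' : ℤ, |stepA x y * stepA x' y'| ≤ 4 := by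
    intro x y x' y'
    rw [abs_of_nonneg (mul_nonneg (stepA_nonneg _ _) (stepA_nonneg _ _))]
    have := mul_le_mul (stepA_le x y) (stepA_le x' y') (stepA_nonneg _ _) (by norm_num)
    linarith
  have i1 : Integrable (fun x : (ℤ × ℤ) × (ℤ × ℤ) => stepA x.1.1 x.2.1 * stepA x.1.2 x.2.2)
      (ν.prod ν) := Integrable.of_bound (Measurable.of_discrete).aestronglyMeasurable 4
      (Eventually.of_forall fun x => hbnd _ _ _ _)
  have i2 : ∀ π : ℤ × ℤ → ℤ, Integrable (fun x : (ℤ × ℤ) × (ℤ × ℤ) => stepA (π x.1) (π x.2))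
      (ν.prod ν) := fun π => Integrable.of_bound (Measurable.of_discrete).aestronglyMeasurable 2
      (Eventually.of_forall fun x => by
        rw [Real.norm_eq_abs, abs_of_nonneg (stepA_nonneg _ _)]; exact stepA_le _ _)
  have hk : kendall μ' DA DB = ∫ x, csign x.1 x.2 ∂(ν.prod ν) := by
    unfold kendall
    have e1 : ∫ ω, scriptH μ' DA DB (DA ω) (DB ω) ∂μ' =
        ∫ x, stepA x.1.1 x.2.1 * stepA x.1.2 x.2.2 ∂(ν.prod ν) := by
      rw [integral_prod _ i1, hν, integral_map hm.aemeasurable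
        (Measurable.of_discrete).aestronglyMeasurable]
      simp only [hS]
      rfl
    rw [e1]
    simp only [csign_eq]
    rw [← int4_sub (ν.prod ν) _ _ _ (fun _ => (1:ℝ)) i1 (i2 Prod.fst) (i2 Prod.snd)
      (integrable_const _), integral_stepA ν Prod.fst, integral_stepA ν Prod.snd]
    simp
  have i3 : Integrable (fun x : (ℤ × ℤ) × (ℤ × ℤ) => csign x.1 x.2) (ν.prod ν) :=
    Integrable.of_bound (Measurable.of_discrete).aestronglyMeasurable 1
      (Eventually.of_forall fun x => abs_csign_le _ _)
  rw [hk, integral_countable i3]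
  refine tsum_congr fun x => ?_
  obtain ⟨z, w⟩ := x
  rw [← Set.singleton_prod_singleton, measureReal_prod_prod, smul_eq_mul]

/-- Point masses from the joint cdf: pointwise identity. -/
lemma point_ind (a b k l : ℤ) : (if (a, b) = (k, l) then (1:ℝ) else 0) =
    (if a ≤ k ∧ b ≤ l then 1 else 0) - (if a ≤ k - 1 ∧ b ≤ l then 1 else 0)
    - (if a ≤ k ∧ b ≤ l - 1 then 1 else 0) + (if a ≤ k - 1 ∧ b ≤ l - 1 then 1 else 0) := by
  simp only [Prod.mk.injEq]
  split_ifs <;> first | (exfalso; omega) | norm_num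

lemma pointMass_eq {Ω' : Type*} [MeasurableSpace Ω'] (μ' : Measure Ω') [IsProbabilityMeasure μ']
    (DA DB : Ω' → ℤ) (hDA : Measurable DA) (hDB : Measurable DB) (k l : ℤ) :
    (μ'.map (fun ω => (DA ω, DB ω))).real {(k, l)} =
      intJointCdf μ' DA DB k l - intJointCdf μ' DA DB (k - 1) l
      - intJointCdf μ' DA DB k (l - 1) + intJointCdf μ' DA DB (k - 1) (l - 1) := by
  have hm : Measurable (fun ω => (DA ω, DB ω)) := hDA.prodMk hDB
  have hms : ∀ k l : ℤ, MeasurableSet {ω | DA ω ≤ k ∧ DB ω ≤ l} := fun k l =>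
    (measurableSet_le hDA measurable_const).inter (measurableSet_le hDB measurable_const)
  have hH : ∀ k l, intJointCdf μ' DA DB k l =
      ∫ ω, (if DA ω ≤ k ∧ DB ω ≤ l then (1:ℝ) else 0) ∂μ' := by
    intro k l
    have : (fun ω => (if DA ω ≤ k ∧ DB ω ≤ l then (1:ℝ) else 0)) =
        Set.indicator {ω | DA ω ≤ k ∧ DB ω ≤ l} 1 := by
      ext w; simp [Set.indicator_apply]
    rw [this, integral_indicator_one (hms k l)]
    rfl
  have hint : ∀ k l : ℤ, Integrable (fun ω => (if DA ω ≤ k ∧ DB ω ≤ l then (1:ℝ) else 0)) μ' :=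
    fun k l => Integrable.of_bound
      (Measurable.ite (hms k l) measurable_const measurable_const).aestronglyMeasurable 1
      (Eventually.of_forall fun w => by split_ifs <;> simp)
  have hp : (μ'.map (fun ω => (DA ω, DB ω))).real {(k, l)} =
      ∫ ω, (if (DA ω, DB ω) = (k, l) then (1:ℝ) else 0) ∂μ' := by
    have : (fun ω => (if (DA ω, DB ω) = (k, l) then (1:ℝ) else 0)) =
        Set.indicator ((fun ω => (DA ω, DB ω)) ⁻¹' {(k, l)}) 1 := by
      ext w
      by_cases hw : (DA w, DB w) = (k, l)
      · rw [if_pos hw, Set.indicator_of_mem (by exact hw)]; rfl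
      · rw [if_neg hw, Set.indicator_of_notMem (by exact hw)]
    rw [this, integral_indicator_one (hm MeasurableSet.of_discrete), measureReal_def,
      Measure.map_apply hm MeasurableSet.of_discrete]
    rfl
  rw [hp, hH, hH, hH, hH, int4_sub μ' _ _ _ _ (hint _ _) (hint _ _) (hint _ _) (hint _ _)]
  exact integral_congr_ae (Eventually.of_forall fun ω => point_ind _ _ _ _)

/-- Degree pair of an edge. -/
def degPair {V : Type*} [Fintype V] (m : V × V → ℕ) (α β : Bool) (e : V × V) : ℤ × ℤ :=
  ((deg m α e.1 : ℤ), (deg m β e.2 : ℤ))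

/-- Empirical point masses. -/
noncomputable def empMass {V : Type*} [Fintype V] (m : V × V → ℕ) (α β : Bool)
    (z : ℤ × ℤ) : ℝ :=
  ∑ e, (m e : ℝ) / (edgeCount m : ℝ) * (if degPair m α β e = z then 1 else 0)

lemma empMass_nonneg {V : Type*} [Fintype V] (m : V × V → ℕ) (α β : Bool) (z : ℤ × ℤ) :
    0 ≤ empMass m α β z := by unfold empMass; positivity

lemma empMass_eq {V : Type*} [Fintype V] (m : V × V → ℕ) (α β : Bool) (k l : ℤ) :
    empMass m α β (k, l) = empJointCdf m α β k l - empJointCdf m α β (k - 1) l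
      - empJointCdf m α β k (l - 1) + empJointCdf m α β (k - 1) (l - 1) := by
  unfold empMass empJointCdf degPair
  rw [← Finset.sum_sub_distrib, ← Finset.sum_sub_distrib, ← Finset.sum_add_distrib]
  refine Finset.sum_congr rfl fun e _ => ?_
  rw [point_ind]; ring

lemma empMass_hasSum {V : Type*} [Fintype V] (m : V × V → ℕ) (α β : Bool)
    (h : 0 < edgeCount m) : HasSum (empMass m α β) 1 := by
  have h1 : HasSum (empMass m α β) (∑ e, (m e : ℝ) / (edgeCount m : ℝ)) := by
    refine hasSum_sum fun e _ => ?_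
    have := hasSum_ite_eq (degPair m α β e) ((m e : ℝ) / (edgeCount m : ℝ))
    convert! this using 2 with z
    by_cases hz : degPair m α β e = z
    · rw [if_pos hz, if_pos hz.symm, mul_one]
    · rw [if_neg hz, if_neg (Ne.symm hz), mul_zero]
  have h2 : ∑ e, (m e : ℝ) / (edgeCount m : ℝ) = 1 := by
    rw [← Finset.sum_div, div_eq_one_iff_eq (by positivity)]
    simp [edgeCount]
  rwa [h2] at h1

lemma emp_bilin {V : Type*} [Fintype V] (m : V × V → ℕ) (α β : Bool) :
    ∑' x : (ℤ × ℤ) × (ℤ × ℤ), empMass m α β x.1 * empMass m α β x.2 * csign x.1 x.2 =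
      (∑ e, ∑ f, (m e : ℝ) * (m f : ℝ) * csign (degPair m α β e) (degPair m α β f)) /
        (edgeCount m : ℝ) ^ 2 := by
  refine HasSum.tsum_eq ?_
  rw [Finset.sum_div]
  simp_rw [Finset.sum_div]
  have e : (fun x : (ℤ × ℤ) × (ℤ × ℤ) =>
      empMass m α β x.1 * empMass m α β x.2 * csign x.1 x.2) = fun x => ∑ e, ∑ f,
        if x = (degPair m α β e, degPair m α β f) then
          (m e : ℝ) * (m f : ℝ) * csign (degPair m α β e) (degPair m α β f) /
            (edgeCount m : ℝ) ^ 2 else 0 := by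
    ext ⟨z, w⟩
    unfold empMass
    rw [Finset.sum_mul_sum, Finset.sum_mul]
    refine Finset.sum_congr rfl fun e _ => ?_
    rw [Finset.sum_mul]
    refine Finset.sum_congr rfl fun f _ => ?_
    by_cases h1 : degPair m α β e = z
    · by_cases h2 : degPair m α β f = w
      · subst h1 h2
        simp only [if_true]
        ring
      · rw [if_neg h2, if_neg (fun h => h2 (Prod.mk.inj h).2.symm)]; simp
    · rw [if_neg h1, if_neg (fun h => h1 (Prod.mk.inj h).1.symm)]; simp
  rw [e]
  exact hasSum_sum fun e _ => hasSum_sum fun f _ => hasSum_ite_eq _ _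

lemma tauStat_eq {V : Type*} [Fintype V] [DecidableEq V] (m : V × V → ℕ) (α β : Bool) :
    tauStat m α β =
      (∑ e, ∑ f, (m e : ℝ) * (m f : ℝ) * csign (degPair m α β e) (degPair m α β f)) /
        ((edgeCount m : ℝ) * ((edgeCount m : ℝ) - 1)) := by
  unfold tauStat
  congr 1
  rw [Finset.natCast_card_filter, Finset.natCast_card_filter, ← Finset.sum_sub_distrib]
  have : ∀ p : ((e : V × V) × Fin (m e)) × ((e : V × V) × Fin (m e)),
      ((if p.1 ≠ p.2 ∧ 0 < ((deg m α p.1.1.1 : ℤ) - (deg m α p.2.1.1 : ℤ)) *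
          ((deg m β p.1.1.2 : ℤ) - (deg m β p.2.1.2 : ℤ)) then (1:ℝ) else 0) -
       (if p.1 ≠ p.2 ∧ ((deg m α p.1.1.1 : ℤ) - (deg m α p.2.1.1 : ℤ)) *
          ((deg m β p.1.1.2 : ℤ) - (deg m β p.2.1.2 : ℤ)) < 0 then (1:ℝ) else 0)) =
      csign (degPair m α β p.1.1) (degPair m α β p.2.1) := by
    rintro ⟨x, y⟩
    by_cases hxy : x = y
    · subst hxy; simp [csign]
    · simp only [ne_eq, hxy, not_false_eq_true, true_and, csign, degPair]
      generalize ((deg m α x.1.1 : ℤ) - (deg m α y.1.1 : ℤ)) *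
          ((deg m β x.1.2 : ℤ) - (deg m β y.1.2 : ℤ)) = t
      rcases lt_trichotomy t 0 with h | h | h
      · rw [Int.sign_eq_neg_one_of_neg h, if_neg (by omega), if_pos h]; simp
      · subst h; simp
      · rw [Int.sign_eq_one_of_pos h, if_pos h, if_neg (by omega)]; simp
  rw [Finset.sum_congr rfl fun p _ => this p, Fintype.sum_prod_type, Fintype.sum_sigma]
  refine Finset.sum_congr rfl fun e _ => ?_
  simp only [Fintype.sum_sigma, Finset.sum_const, Finset.card_univ, Fintype.card_fin,
    nsmul_eq_mul, Finset.mul_sum]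
  refine Finset.sum_congr rfl fun f _ => by ring

/-- Under the regularity condition and `|E_n| → ∞` in probability,
Kendall's tau statistic is consistent: `τ_α^β(G_n) → τ(𝒟^α,𝒟^β)` in probability. -/
theorem tau_consistency
    {Ω : Type*} [MeasurableSpace Ω] (μ : Measure Ω) [IsProbabilityMeasure μ]
    {Ω' : Type*} [MeasurableSpace Ω'] (μ' : Measure Ω') [IsProbabilityMeasure μ']
    (α β : Bool)
    (M : (n : ℕ) → Ω → (Fin n × Fin n → ℕ))
    (hM : ∀ n, Measurable (M n))
    (DA DB : Ω' → ℤ) (hDA : Measurable DA) (hDB : Measurable DB)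
    (hndA : ∀ k, μ' {ω | DA ω = k} < 1)
    (hndB : ∀ l, μ' {ω | DB ω = l} < 1)
    (hEinf : ∀ K : ℕ, Tendsto (fun n => μ {ω | edgeCount (M n ω) < K}) atTop (nhds 0))
    (hH : ∀ k l : ℤ, TendstoInMeasure μ (fun n ω => empJointCdf (M n ω) α β k l) atTop
      (fun _ => intJointCdf μ' DA DB k l)) :
    TendstoInMeasure μ (fun n ω => tauStat (M n ω) α β) atTop
      (fun _ => kendall μ' DA DB) := by
  rw [tendstoInMeasure_iff_probFilter]
  simp_rw [tendstoInMeasure_iff_probFilter] at hH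
  have hE : Tendsto (fun x : ℕ × Ω => edgeCount (M x.1 x.2)) (probFilter μ) atTop := by
    rw [tendsto_atTop]
    intro K
    rw [Filter.Eventually, mem_probFilter]
    simpa using hEinf K
  have hm : Measurable (fun ω => (DA ω, DB ω)) := hDA.prodMk hDB
  have : IsProbabilityMeasure (μ'.map (fun ω => (DA ω, DB ω))) :=
    Measure.isProbabilityMeasure_map hm.aemeasurable
  have hmass : ∀ z : ℤ × ℤ, Tendsto (fun x : ℕ × Ω => empMass (M x.1 x.2) α β z) (probFilter μ)
      (nhds ((μ'.map (fun ω => (DA ω, DB ω))).real {z})) := by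
    rintro ⟨k, l⟩
    simp only [empMass_eq, pointMass_eq μ' DA DB hDA hDB]
    exact (((hH _ _).sub (hH _ _)).sub (hH _ _)).add (hH _ _)
  have hp : HasSum (fun z : ℤ × ℤ => (μ'.map (fun ω => (DA ω, DB ω))).real {z}) 1 :=
    hasSum_singletons _
  have hpos : ∀ᶠ x : ℕ × Ω in probFilter μ, 1 < edgeCount (M x.1 x.2) :=
    hE.eventually_gt_atTop 1
  have hk := kendall_eq μ' DA DB hDA hDB
  have hp0 : ∀ z : ℤ × ℤ, 0 ≤ (μ'.map (fun ω => (DA ω, DB ω))).real {z} :=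
    fun z => measureReal_nonneg
  obtain ⟨p, hpdef⟩ : ∃ p : ℤ × ℤ → ℝ, ∀ z, (μ'.map (fun ω => (DA ω, DB ω))).real {z} = p z :=
    ⟨_, fun _ => rfl⟩
  simp only [hpdef] at hk hp0 hp hmass
  have hl1 := tendsto_l1 (probFilter μ) (fun x z => empMass (M x.1 x.2) α β z) p
    (fun x z => empMass_nonneg _ _ _ _) hp0 hp
    (hpos.mono fun x hx => empMass_hasSum _ _ _ (by omega)) hmass
  have hT : Tendsto (fun x : ℕ × Ω => ∑' y : (ℤ × ℤ) × (ℤ × ℤ),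
      empMass (M x.1 x.2) α β y.1 * empMass (M x.1 x.2) α β y.2 * csign y.1 y.2)
      (probFilter μ) (nhds (kendall μ' DA DB)) := by
    rw [tendsto_iff_norm_sub_tendsto_zero]
    have h2 := hl1.const_mul 2
    rw [mul_zero] at h2
    refine tendsto_of_tendsto_of_tendsto_of_le_of_le' tendsto_const_nhds h2
      (Eventually.of_forall fun x => norm_nonneg _) ?_
    filter_upwards [hpos] with x hx
    rw [hk, Real.norm_eq_abs]
    exact bilin_bound (empMass (M x.1 x.2) α β) p csign abs_csign_le (fun z => empMass_nonneg _ _ _ _)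
      hp0 hp (empMass_hasSum _ _ _ (by omega))
  have hR : Tendsto (fun x : ℕ × Ω => 1 + ((edgeCount (M x.1 x.2) : ℝ) - 1)⁻¹)
      (probFilter μ) (nhds 1) := by
    have h1 : Tendsto (fun x : ℕ × Ω => (edgeCount (M x.1 x.2) : ℝ) - 1) (probFilter μ) atTop :=
      tendsto_atTop_add_const_right _ (-1) (tendsto_natCast_atTop_atTop.comp hE)
    simpa using (tendsto_const_nhds (x := (1:ℝ))).add (tendsto_inv_atTop_zero.comp h1)
  have hfin := hR.mul hT
  rw [one_mul] at hfin
  refine hfin.congr' ?_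
  filter_upwards [hpos] with x hx
  rw [emp_bilin, tauStat_eq]
  have hx1 : (1:ℝ) < (edgeCount (M x.1 x.2) : ℝ) := by exact_mod_cast hx
  have hne : (edgeCount (M x.1 x.2) : ℝ) ≠ 0 := by linarith
  have hne' : (edgeCount (M x.1 x.2) : ℝ) - 1 ≠ 0 := by linarith
  field_simp
  ring
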